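/- Let T > 0 and let u be a time-dependent vector field on [0,T]×ℝ³ with finite Gevrey norm ‖u‖_{Z_T} := sup_{0<t≤T} t^{1/8} ‖ |ξ|^{3/4} e^{(√t/2)|ξ|} û(t,ξ) ‖_{L²_ξ}. Then there is a constant C (depending only on the coefficients α of the bilinear form Q) such that for every t ∈ (0,T]: t^{1/8} ∫₀^t ‖ e^{(√t/2)|D|} |D|^{3/4} e^{(t−s)Δ} Q(u(s), u(s)) ‖_{L²} ds ≤ C ‖u‖_{Z_T}². -/

import Mathlib

noncomputable section

open MeasureTheory Set Filter
open scoped ENNReal Topology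

/-- Frequency space ℝ³ (as functions `Fin 3 → ℝ`, with the product Lebesgue measure). -/
abbrev V3 : Type := Fin 3 → ℝ

/-- The Euclidean norm on `V3`. -/
def en (ξ : V3) : ℝ := Real.sqrt (∑ i, ξ i ^ 2)

/-- Squared Euclidean magnitude of a vector in ℂ³. -/
def vnSq (v : Fin 3 → ℂ) : ℝ := ∑ j, ‖v j‖ ^ 2

/-- Weighted L²-norm in the frequency variable, valued in `ℝ≥0∞`:
`wnorm w f = ( ∫ (w ξ)² |f ξ|² dξ )^{1/2}`. -/
def wnorm (w : V3 → ℝ) (f : V3 → Fin 3 → ℂ) : ℝ≥0∞ :=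
  (∫⁻ ξ : V3, ENNReal.ofReal (w ξ ^ 2 * vnSq (f ξ))) ^ ((1 : ℝ) / 2)

/-- Weight of the inhomogeneous Sobolev norm `H^γ`, i.e. `⟨ξ⟩^γ`. -/
def wH (γ : ℝ) : V3 → ℝ := fun ξ => (1 + en ξ ^ 2) ^ (γ / 2)

/-- Weight of the homogeneous Sobolev norm `Ḣ^s`, i.e. `|ξ|^s`. -/
def wD (s : ℝ) : V3 → ℝ := fun ξ => en ξ ^ s

/-- Coefficients `α^{j,m,n,p}_{k,ℓ}` of the bilinear form `Q`
(order of arguments: `α j m n p k l`). -/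
abbrev Coeffs : Type := Fin 3 → Fin 3 → Fin 3 → Fin 3 → Fin 3 → Fin 3 → ℝ

/-- The symbol `q^{j,m}_{k,ℓ}(ξ) = Σ_{n,p} α^{j,m,n,p}_{k,ℓ} ξ_n ξ_p / |ξ|²`. -/
def qsym (α : Coeffs) (j m k l : Fin 3) (ξ : V3) : ℝ :=
  ∑ n, ∑ p, α j m n p k l * (ξ n * ξ p) / en ξ ^ 2

/-- Fourier side of the bilinear term `Q(u,v)`: with the convention
`f̂(ξ) = ∫ f(x) e^{-ix·ξ} dx`, the product `u^k v^ℓ` has Fourier transform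
`(2π)⁻³ (û^k ∗ v̂^ℓ)(ξ)`, so that
`(Q^j(u,v))^(ξ) = Σ_{k,ℓ,m} q^{j,m}_{k,ℓ}(ξ) · iξ_m · (2π)⁻³ (û^k ∗ v̂^ℓ)(ξ)`. -/
def Qhat (α : Coeffs) (U W : V3 → Fin 3 → ℂ) : V3 → Fin 3 → ℂ := fun ξ j =>
  ∑ k : Fin 3, ∑ l : Fin 3, ∑ m : Fin 3,
    (qsym α j m k l ξ : ℂ) * (Complex.I * (ξ m : ℂ)) *
      ((((2 * Real.pi) ^ (3 : ℕ))⁻¹ : ℝ) : ℂ) * ∫ η : V3, U η k * W (ξ - η) l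

/-- `U` is (the Fourier transform of) a mild solution of the generalized Navier–Stokes
equations on `[0,T]` with (Fourier-side) data `U₀`:
`û(t,ξ) = e^{-t|ξ|²} û₀(ξ) + ∫₀^t e^{-(t-s)|ξ|²} (Q(u,u))^(s,ξ) ds`. -/
def IsMildSol (α : Coeffs) (U₀ : V3 → Fin 3 → ℂ) (U : ℝ → V3 → Fin 3 → ℂ) (T : ℝ) : Prop :=
  ∀ t ∈ Icc (0 : ℝ) T, ∀ ξ : V3, ∀ j : Fin 3,
    U t ξ j = (Real.exp (-(t * en ξ ^ 2)) : ℂ) * U₀ ξ j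
      + ∫ s in (0 : ℝ)..t, (Real.exp (-((t - s) * en ξ ^ 2)) : ℂ) * Qhat α (U s) (U s) ξ j

/-- Continuity on `[0,T]` with values in the weighted L²-space with weight `w`
(this encodes `u ∈ C([0,T]; H)` for the corresponding Sobolev space `H`). -/
def ContInW (w : V3 → ℝ) (U : ℝ → V3 → Fin 3 → ℂ) (T : ℝ) : Prop :=
  (∀ t ∈ Icc (0 : ℝ) T, wnorm w (U t) < ⊤) ∧
  ∀ t ∈ Icc (0 : ℝ) T, ∀ ε : ℝ≥0∞, 0 < ε → ∃ d > (0 : ℝ), ∀ s ∈ Icc (0 : ℝ) T,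
    |s - t| < d → wnorm w (fun ξ j => U s ξ j - U t ξ j) < ε

/-- Membership in `L²((0,T); H)` for the weighted space `H` with weight `w`. -/
def MemL2W (w : V3 → ℝ) (U : ℝ → V3 → Fin 3 → ℂ) (T : ℝ) : Prop :=
  ∫⁻ t in Ioo (0 : ℝ) T, wnorm w (U t) ^ (2 : ℕ) < ⊤

/-- Joint measurability of a time-dependent (Fourier-side) vector field. -/
def MeasVF (U : ℝ → V3 → Fin 3 → ℂ) : Prop :=
  ∀ j : Fin 3, Measurable (Function.uncurry fun t ξ => U t ξ j)

/-- Divergence-free condition on the Fourier side: `ξ · û₀(ξ) = 0`. -/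
def DivFree (U₀ : V3 → Fin 3 → ℂ) : Prop := ∀ ξ : V3, ∑ j : Fin 3, (ξ j : ℂ) * U₀ ξ j = 0

/-- `U₀` is the Fourier transform of a real (ℝ³-valued) vector field. -/
def RealField (U₀ : V3 → Fin 3 → ℂ) : Prop :=
  ∀ ξ : V3, ∀ j : Fin 3, U₀ (-ξ) j = (starRingEnd ℂ) (U₀ ξ j)

/-- The Gevrey norm `‖u‖_{Z_T} = sup_{0<t≤T} t^{1/8} ‖ |ξ|^{3/4} e^{(√t/2)|ξ|} û(t,ξ) ‖_{L²}`. -/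
def Znorm (T : ℝ) (U : ℝ → V3 → Fin 3 → ℂ) : ℝ≥0∞ :=
  ⨆ t ∈ Ioc (0 : ℝ) T, ENNReal.ofReal (t ^ ((1 : ℝ) / 8)) *
    wnorm (fun ξ => en ξ ^ ((3 : ℝ) / 4) * Real.exp (Real.sqrt t / 2 * en ξ)) (U t)

theorem sq_lintegral_mul_le {X : Type*} [MeasurableSpace X] (μ : Measure X) {f g : X → ℝ≥0∞}
    (hf : AEMeasurable f μ) (hg : AEMeasurable g μ) :
    (∫⁻ x, f x * g x ∂μ) ^ 2 ≤ (∫⁻ x, f x ^ 2 ∂μ) * ∫⁻ x, g x ^ 2 ∂μ := by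
  have h := ENNReal.lintegral_mul_le_Lp_mul_Lq μ Real.HolderConjugate.two_two hf hg
  have hsq : ∀ a : ℝ≥0∞, (a ^ ((1 : ℝ) / 2)) ^ 2 = a := fun a => by
    rw [← ENNReal.rpow_natCast, ← ENNReal.rpow_mul]; norm_num
  simp only [ENNReal.rpow_two, Pi.mul_apply] at h
  calc _ ≤ _ := pow_le_pow_left' h 2
    _ = _ := by rw [mul_pow, hsq, hsq]

theorem lintegral_Ioc_rpow {c r : ℝ} (hc : -1 < c) (hr : 0 ≤ r) :
    ∫⁻ x in Ioc (0 : ℝ) r, ENNReal.ofReal (x ^ c) = ENNReal.ofReal (r ^ (c + 1) / (c + 1)) := by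
  rw [← ofReal_integral_eq_lintegral_ofReal]
  · rw [← intervalIntegral.integral_of_le hr, integral_rpow (Or.inl hc),
      Real.zero_rpow (by linarith), sub_zero]
  · exact (intervalIntegrable_iff_integrableOn_Ioc_of_le hr).1
      (intervalIntegral.intervalIntegrable_rpow' hc)
  · filter_upwards [ae_restrict_mem measurableSet_Ioc] with x hx using Real.rpow_nonneg hx.1.le _

/-- The potential `‖η‖^{-3/2}` has mass of order `r^{3/2}` on the ball of radius `r`. -/
theorem exists_lintegral_norm_rpow_le :
    ∃ K : ℝ, 0 ≤ K ∧ ∀ r : ℝ, 0 ≤ r →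
      ∫⁻ η : V3, (if ‖η‖ ≤ r then ENNReal.ofReal (‖η‖ ^ (-(3 / 2) : ℝ)) else 0)
        ≤ ENNReal.ofReal (K * r ^ ((3 : ℝ) / 2)) := by
  refine ⟨3 * ((volume : Measure V3).real (Metric.ball 0 1) * (1 / (3 / 2))), by positivity,
    fun r hr => le_of_eq ?_⟩
  set f : ℝ → ℝ := (Iic r).indicator fun y => y ^ (-(3 / 2) : ℝ) with hf
  have hfn : ∀ η : V3, 0 ≤ f ‖η‖ := fun η =>
    indicator_apply_nonneg fun _ => Real.rpow_nonneg (norm_nonneg _) _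
  have hmul : EqOn (fun y : ℝ => y ^ (Module.finrank ℝ V3 - 1) • f y)
      ((Iic r).indicator fun y => y ^ ((1 : ℝ) / 2)) (Ioi 0) := by
    intro y (hy : 0 < y)
    by_cases h : y ∈ Iic r
    · simp only [hf, indicator_of_mem h, Module.finrank_fintype_fun_eq_card, Fintype.card_fin,
        smul_eq_mul]
      rw [← Real.rpow_natCast, ← Real.rpow_add hy]; norm_num
    · simp [hf, indicator_of_notMem h]
  have hint : IntegrableOn (fun y : ℝ => y ^ ((1 : ℝ) / 2)) (Ioc 0 r) :=
    (intervalIntegrable_iff_integrableOn_Ioc_of_le hr).1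
      (intervalIntegral.intervalIntegrable_rpow' (by norm_num))
  have hI : Integrable (fun η : V3 => f ‖η‖) := by
    rw [integrable_fun_norm_addHaar, integrableOn_congr_fun hmul measurableSet_Ioi,
      integrableOn_indicator_iff measurableSet_Iic, Iic_inter_Ioi]
    exact hint
  have hval : ∫ η : V3, f ‖η‖ = 3 * ((volume : Measure V3).real (Metric.ball 0 1) * (1 / (3 / 2)))
      * r ^ ((3 : ℝ) / 2) := by
    rw [integral_fun_norm_addHaar, setIntegral_congr_fun measurableSet_Ioi hmul,
      setIntegral_indicator measurableSet_Iic, Ioi_inter_Iic,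
      ← intervalIntegral.integral_of_le hr, integral_rpow (Or.inl (by norm_num))]
    norm_num
    ring
  rw [← hval, ofReal_integral_eq_lintegral_ofReal hI (Eventually.of_forall hfn)]
  refine lintegral_congr fun η => ?_
  by_cases h : ‖η‖ ≤ r
  · simp [hf, h]
  · simp [hf, h]

/-- Fourier-side form of the product estimate `Ḣ^{3/4} · Ḣ^{3/4} ⊂ L²` on `ℝ³`. -/
theorem exists_lintegral_sq_conv_le :
    ∃ K : ℝ, 0 ≤ K ∧ ∀ G : V3 → ℝ≥0∞, Measurable G →
      ∫⁻ ξ : V3, (∫⁻ η : V3, (ENNReal.ofReal (‖η‖ ^ (-(3 / 4) : ℝ)) * G η) *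
          (ENNReal.ofReal (‖ξ - η‖ ^ (-(3 / 4) : ℝ)) * G (ξ - η))) ^ 2
        ≤ ENNReal.ofReal K * (∫⁻ η : V3, G η ^ 2) ^ 2 := by
  obtain ⟨K, hK, hball⟩ := exists_lintegral_norm_rpow_le
  refine ⟨4 * K, by positivity, fun G hG => ?_⟩
  set k : V3 → ℝ≥0∞ := fun η => ENNReal.ofReal (‖η‖ ^ (-(3 / 4) : ℝ)) with hk
  have hkm : Measurable k := by fun_prop
  have hk2 : ∀ η, k η ^ 2 = ENNReal.ofReal (‖η‖ ^ (-(3 / 2) : ℝ)) := fun η => by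
    rw [hk, ← ENNReal.ofReal_pow (by positivity), ← Real.rpow_natCast,
      ← Real.rpow_mul (norm_nonneg _)]
    norm_num
  set H : V3 → V3 → ℝ≥0∞ := fun η ζ => if ‖η‖ ≤ ‖ζ‖ then k η * (k ζ * G ζ) else 0 with hH
  have hHm : Measurable (Function.uncurry H) :=
    Measurable.ite (measurableSet_le (by fun_prop) (by fun_prop)) (by fun_prop) measurable_const
  have hsplit : ∀ ξ, (∫⁻ η : V3, (k η * G η) * (k (ξ - η) * G (ξ - η)))
      ≤ 2 * ∫⁻ η, G η * H η (ξ - η) := by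
    intro ξ
    have hsymm : ∫⁻ η, G (ξ - η) * H (ξ - η) η = ∫⁻ η, G η * H η (ξ - η) := by
      simpa using lintegral_sub_left_eq_self (μ := volume) (fun η => G η * H η (ξ - η)) ξ
    have hm : Measurable fun η => H η (ξ - η) :=
      hHm.comp (measurable_id.prodMk (measurable_const.sub measurable_id))
    calc _ ≤ ∫⁻ η, (G η * H η (ξ - η) + G (ξ - η) * H (ξ - η) η) := by
          refine lintegral_mono fun η => ?_
          rcases le_total ‖η‖ ‖ξ - η‖ with h | h
          · refine le_trans (le_of_eq ?_) le_self_add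
            simp only [hH, if_pos h]; ring
          · refine le_trans (le_of_eq ?_) le_add_self
            simp only [hH, if_pos h]; ring
      _ = _ := by
          rw [lintegral_add_left (f := fun η => G η * H η (ξ - η)) (hG.mul hm), hsymm, two_mul]
  have hsq : ∀ ξ, (∫⁻ η : V3, (k η * G η) * (k (ξ - η) * G (ξ - η))) ^ 2
      ≤ 4 * (∫⁻ η, G η ^ 2) * ∫⁻ η, H η (ξ - η) ^ 2 := by
    intro ξ
    have hm : Measurable fun η => H η (ξ - η) :=
      hHm.comp (measurable_id.prodMk (measurable_const.sub measurable_id))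
    calc _ ≤ (2 * ∫⁻ η, G η * H η (ξ - η)) ^ 2 := pow_le_pow_left' (hsplit ξ) 2
      _ = 4 * (∫⁻ η, G η * H η (ξ - η)) ^ 2 := by rw [mul_pow]; norm_num
      _ ≤ 4 * ((∫⁻ η, G η ^ 2) * ∫⁻ η, H η (ξ - η) ^ 2) := by
          gcongr
          exact sq_lintegral_mul_le _ hG.aemeasurable hm.aemeasurable
      _ = _ := by ring
  have hin : ∀ ζ, ∫⁻ η, H η ζ ^ 2 ≤ ENNReal.ofReal K * G ζ ^ 2 := by
    intro ζ
    calc ∫⁻ η, H η ζ ^ 2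
        = ∫⁻ η, (if ‖η‖ ≤ ‖ζ‖ then ENNReal.ofReal (‖η‖ ^ (-(3 / 2) : ℝ)) else 0)
            * (k ζ ^ 2 * G ζ ^ 2) := by
          refine lintegral_congr fun η => ?_
          by_cases h : ‖η‖ ≤ ‖ζ‖
          · simp only [hH, if_pos h, mul_pow, hk2]
          · simp [hH, if_neg h]
      _ = (∫⁻ η : V3, (if ‖η‖ ≤ ‖ζ‖ then ENNReal.ofReal (‖η‖ ^ (-(3 / 2) : ℝ)) else 0))
            * (k ζ ^ 2 * G ζ ^ 2) :=
          lintegral_mul_const _ (Measurable.ite (measurableSet_le (by fun_prop) (by fun_prop))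
            (by fun_prop) measurable_const)
      _ ≤ ENNReal.ofReal (K * ‖ζ‖ ^ ((3 : ℝ) / 2)) * (k ζ ^ 2 * G ζ ^ 2) := by
          gcongr
          exact hball _ (norm_nonneg _)
      _ = ENNReal.ofReal (K * (‖ζ‖ ^ ((3 : ℝ) / 2) * ‖ζ‖ ^ (-(3 / 2) : ℝ))) * G ζ ^ 2 := by
          rw [hk2, ← mul_assoc, ← ENNReal.ofReal_mul (by positivity), mul_assoc]
      _ ≤ _ := by
          gcongr
          refine mul_le_of_le_one_right hK ?_
          rw [Real.rpow_neg (norm_nonneg _)]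
          exact mul_inv_le_one
  calc _ ≤ ∫⁻ ξ, 4 * (∫⁻ η, G η ^ 2) * ∫⁻ η, H η (ξ - η) ^ 2 := lintegral_mono hsq
    _ = 4 * (∫⁻ η, G η ^ 2) * ∫⁻ ξ, ∫⁻ η, H η (ξ - η) ^ 2 := by
        refine lintegral_const_mul _ (Measurable.lintegral_prod_right' (f := fun p : V3 × V3 =>
          H p.2 (p.1 - p.2) ^ 2) ?_)
        exact (hHm.comp (measurable_snd.prodMk (measurable_fst.sub measurable_snd))).pow_const 2
    _ = 4 * (∫⁻ η, G η ^ 2) * ∫⁻ η, ∫⁻ ξ, H η (ξ - η) ^ 2 := by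
        rw [lintegral_lintegral_swap]
        exact ((hHm.comp (measurable_snd.prodMk
          (measurable_fst.sub measurable_snd))).pow_const 2).aemeasurable
    _ = 4 * (∫⁻ η, G η ^ 2) * ∫⁻ η, ∫⁻ ζ, H η ζ ^ 2 := by
        congr 1
        exact lintegral_congr fun η =>
          lintegral_sub_right_eq_self (μ := volume) (fun ζ => H η ζ ^ 2) η
    _ = 4 * (∫⁻ η, G η ^ 2) * ∫⁻ ζ, ∫⁻ η, H η ζ ^ 2 := by
        rw [lintegral_lintegral_swap (hHm.pow_const 2).aemeasurable]
    _ ≤ 4 * (∫⁻ η, G η ^ 2) * ∫⁻ ζ, ENNReal.ofReal K * G ζ ^ 2 := by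
        gcongr with ζ
        exact hin ζ
    _ = _ := by
        rw [lintegral_const_mul _ (hG.pow_const 2), ENNReal.ofReal_mul (by norm_num)]
        norm_num
        ring

theorem lintegral_Ioc_sub_rpow {c t : ℝ} (hc : -1 < c) (ht : 0 ≤ t) :
    ∫⁻ s in Ioc (0 : ℝ) t, ENNReal.ofReal ((t - s) ^ c)
      = ENNReal.ofReal (t ^ (c + 1) / (c + 1)) := by
  rw [← ofReal_integral_eq_lintegral_ofReal]
  · rw [← intervalIntegral.integral_of_le ht,
      intervalIntegral.integral_comp_sub_left (fun x => x ^ c) t, sub_self, sub_zero,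
      integral_rpow (Or.inl hc), Real.zero_rpow (by linarith), sub_zero]
  · refine (intervalIntegrable_iff_integrableOn_Ioc_of_le ht).1 ?_
    simpa using ((intervalIntegral.intervalIntegrable_rpow' (a := 0) (b := t) hc).comp_sub_left
      t).symm
  · filter_upwards [ae_restrict_mem measurableSet_Ioc] with x hx
      using Real.rpow_nonneg (sub_nonneg.2 hx.2) _

theorem rpow_neg_le_two_mul {c x t : ℝ} (hc : 0 ≤ c) (hc1 : c ≤ 1) (ht : 0 < t)
    (hx : t / 2 ≤ x) : x ^ (-c) ≤ 2 * t ^ (-c) := by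
  calc x ^ (-c) ≤ (t / 2) ^ (-c) :=
        Real.rpow_le_rpow_of_nonpos (by positivity) hx (by linarith)
    _ = 2 ^ c * t ^ (-c) := by
        rw [Real.div_rpow ht.le (by norm_num), Real.rpow_neg (by norm_num : (0 : ℝ) ≤ 2),
          div_inv_eq_mul, mul_comm]
    _ ≤ 2 * t ^ (-c) := by
        gcongr
        calc (2 : ℝ) ^ c ≤ 2 ^ (1 : ℝ) := Real.rpow_le_rpow_of_exponent_le (by norm_num) hc1
          _ = 2 := Real.rpow_one 2

/-- The time integral `∫₀ᵗ (t-s)^{-7/8} s^{-1/4} ds` is at most `20 t^{-1/8}`. -/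
theorem lintegral_time_kernel_le {t : ℝ} (ht : 0 < t) :
    ∫⁻ s in Ioc (0 : ℝ) t,
        ENNReal.ofReal ((t - s) ^ (-(7 / 8) : ℝ) * s ^ (-(1 / 4) : ℝ))
      ≤ ENNReal.ofReal (20 * t ^ (-(1 / 8) : ℝ)) := by
  have hpt : ∀ s ∈ Ioc (0 : ℝ) t, ENNReal.ofReal ((t - s) ^ (-(7 / 8) : ℝ) * s ^ (-(1 / 4) : ℝ))
      ≤ ENNReal.ofReal (2 * t ^ (-(7 / 8) : ℝ)) * ENNReal.ofReal (s ^ (-(1 / 4) : ℝ))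
        + ENNReal.ofReal (2 * t ^ (-(1 / 4) : ℝ)) * ENNReal.ofReal ((t - s) ^ (-(7 / 8) : ℝ)) := by
    intro s hs
    have h1 : 0 ≤ s ^ (-(1 / 4) : ℝ) := Real.rpow_nonneg hs.1.le _
    have h2 : 0 ≤ (t - s) ^ (-(7 / 8) : ℝ) := Real.rpow_nonneg (sub_nonneg.2 hs.2) _
    rw [← ENNReal.ofReal_mul (by positivity), ← ENNReal.ofReal_mul (by positivity),
      ← ENNReal.ofReal_add (by positivity) (by positivity)]
    apply ENNReal.ofReal_le_ofReal
    rcases le_total s (t / 2) with h | h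
    · refine le_trans ?_ (le_add_of_nonneg_right (by positivity))
      gcongr
      exact rpow_neg_le_two_mul (by norm_num) (by norm_num) ht (by linarith)
    · refine le_trans ?_ (le_add_of_nonneg_left (by positivity))
      rw [mul_comm]
      gcongr
      exact rpow_neg_le_two_mul (by norm_num) (by norm_num) ht h
  have e1 : t ^ (-(7 / 8) : ℝ) * t ^ (-(1 / 4) + 1 : ℝ) = t ^ (-(1 / 8) : ℝ) := by
    rw [← Real.rpow_add ht]; norm_num
  have e2 : t ^ (-(1 / 4) : ℝ) * t ^ (-(7 / 8) + 1 : ℝ) = t ^ (-(1 / 8) : ℝ) := by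
    rw [← Real.rpow_add ht]; norm_num
  refine (setLIntegral_mono' measurableSet_Ioc hpt).trans ?_
  rw [lintegral_add_left (by fun_prop), lintegral_const_mul _ (by fun_prop),
    lintegral_const_mul _ (by fun_prop), lintegral_Ioc_rpow (by norm_num) ht.le,
    lintegral_Ioc_sub_rpow (by norm_num) ht.le, ← ENNReal.ofReal_mul (by positivity),
    ← ENNReal.ofReal_mul (by positivity), ← ENNReal.ofReal_add (by positivity) (by positivity)]
  apply ENNReal.ofReal_le_ofReal
  have hp : 0 ≤ t ^ (-(1 / 8) : ℝ) := by positivity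
  calc _ = 2 * (t ^ (-(7 / 8) : ℝ) * t ^ (-(1 / 4) + 1 : ℝ)) / (-(1 / 4) + 1)
        + 2 * (t ^ (-(1 / 4) : ℝ) * t ^ (-(7 / 8) + 1 : ℝ)) / (-(7 / 8) + 1) := by ring
    _ ≤ _ := by
        rw [e1, e2]
        norm_num
        linarith

/-- Parabolic smoothing absorbs `|ξ|^{7/4}` and the Gevrey weight lost between `s` and `t`. -/
theorem heat_gevrey_multiplier_le {s t r : ℝ} (hs : 0 ≤ s) (hst : s < t) (hr : 0 ≤ r) :
    r ^ ((3 : ℝ) / 4) * Real.exp (Real.sqrt t / 2 * r - (t - s) * r ^ 2) * r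
      ≤ 4 * (t - s) ^ (-(7 / 8) : ℝ) * Real.exp (Real.sqrt s / 2 * r) := by
  have hτ : 0 < t - s := sub_pos.2 hst
  set x := Real.sqrt (t - s) * r with hx
  have hx0 : 0 ≤ x := by positivity
  have hx2 : x ^ 2 = (t - s) * r ^ 2 := by rw [hx, mul_pow, Real.sq_sqrt hτ.le]
  have hsqrt : Real.sqrt t ≤ Real.sqrt s + Real.sqrt (t - s) := by
    rw [Real.sqrt_le_left (by positivity), add_sq, Real.sq_sqrt hs, Real.sq_sqrt hτ.le]
    nlinarith [Real.sqrt_nonneg s, Real.sqrt_nonneg (t - s),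
      mul_nonneg (Real.sqrt_nonneg s) (Real.sqrt_nonneg (t - s))]
  have hpow : r ^ ((3 : ℝ) / 4) * r = (t - s) ^ (-(7 / 8) : ℝ) * x ^ ((7 : ℝ) / 4) := by
    have h1 : r ^ ((3 : ℝ) / 4) * r = r ^ ((7 : ℝ) / 4) := by
      rw [← Real.rpow_add_one' hr (by norm_num)]; norm_num
    rw [h1, hx, Real.mul_rpow (Real.sqrt_nonneg _) hr, ← mul_assoc, Real.sqrt_eq_rpow,
      ← Real.rpow_mul hτ.le, ← Real.rpow_add hτ]
    norm_num
  have hxp : x ^ ((7 : ℝ) / 4) ≤ 2 * Real.exp (x ^ 2 / 2) := by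
    have h1 : x ^ ((7 : ℝ) / 4) ≤ 1 + x ^ 2 := by
      rcases le_total x 1 with h | h
      · exact (Real.rpow_le_one hx0 h (by norm_num)).trans (by nlinarith)
      · calc x ^ ((7 : ℝ) / 4) ≤ x ^ (2 : ℝ) :=
              Real.rpow_le_rpow_of_exponent_le h (by norm_num)
          _ ≤ 1 + x ^ 2 := by rw [Real.rpow_two]; linarith
    linarith [Real.add_one_le_exp (x ^ 2 / 2)]
  have hexp : Real.exp (x ^ 2 / 2) * Real.exp (Real.sqrt t / 2 * r - (t - s) * r ^ 2)
      ≤ 2 * Real.exp (Real.sqrt s / 2 * r) := by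
    rw [← Real.exp_log (by norm_num : (0 : ℝ) < 2), ← Real.exp_add, ← Real.exp_add,
      Real.exp_log (by norm_num : (0 : ℝ) < 2)]
    apply Real.exp_le_exp.2
    have := mul_le_mul_of_nonneg_right hsqrt hr
    nlinarith [Real.log_two_gt_d9, sq_nonneg (x - 1 / 2)]
  calc _ = (t - s) ^ (-(7 / 8) : ℝ) * x ^ ((7 : ℝ) / 4)
        * Real.exp (Real.sqrt t / 2 * r - (t - s) * r ^ 2) := by rw [← hpow]; ring
    _ ≤ (t - s) ^ (-(7 / 8) : ℝ) * (2 * Real.exp (x ^ 2 / 2))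
        * Real.exp (Real.sqrt t / 2 * r - (t - s) * r ^ 2) := by gcongr
    _ = 2 * (t - s) ^ (-(7 / 8) : ℝ) *
        (Real.exp (x ^ 2 / 2) * Real.exp (Real.sqrt t / 2 * r - (t - s) * r ^ 2)) := by ring
    _ ≤ 2 * (t - s) ^ (-(7 / 8) : ℝ) * (2 * Real.exp (Real.sqrt s / 2 * r)) := by gcongr
    _ = _ := by ring

theorem en_eq_norm (ξ : V3) : en ξ = ‖WithLp.toLp 2 ξ‖ := by
  simp [en, EuclideanSpace.norm_eq]

theorem en_nonneg (ξ : V3) : 0 ≤ en ξ := Real.sqrt_nonneg _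

theorem measurable_en : Measurable en := by
  unfold en
  fun_prop

theorem abs_apply_le_en (ξ : V3) (i : Fin 3) : |ξ i| ≤ en ξ :=
  Real.abs_le_sqrt (Finset.single_le_sum (f := fun i => ξ i ^ 2) (fun _ _ => sq_nonneg _)
    (Finset.mem_univ i))

theorem norm_le_en (ξ : V3) : ‖ξ‖ ≤ en ξ :=
  (pi_norm_le_iff_of_nonneg (en_nonneg ξ)).2 (abs_apply_le_en ξ)

theorem en_le_add_sub (ξ η : V3) : en ξ ≤ en η + en (ξ - η) := by
  simp only [en_eq_norm, WithLp.toLp_sub]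
  exact norm_le_insert' _ _ |>.trans_eq rfl

theorem abs_qsym_le (α : Coeffs) (j m k l : Fin 3) (ξ : V3) :
    |qsym α j m k l ξ| ≤ ∑ n, ∑ p, |α j m n p k l| := by
  refine (Finset.abs_sum_le_sum_abs _ _).trans (Finset.sum_le_sum fun n _ =>
    (Finset.abs_sum_le_sum_abs _ _).trans (Finset.sum_le_sum fun p _ => ?_))
  rw [mul_div_assoc, abs_mul]
  refine mul_le_of_le_one_right (abs_nonneg _) ?_
  rw [abs_div, abs_mul, abs_of_nonneg (sq_nonneg (en ξ)), sq]
  exact div_le_one_of_le₀ (mul_le_mul (abs_apply_le_en ξ n) (abs_apply_le_en ξ p)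
    (abs_nonneg _) (en_nonneg ξ)) (mul_nonneg (en_nonneg ξ) (en_nonneg ξ))

/-- Pointwise Euclidean length of a `ℂ³`-valued field. -/
def fieldSize (U : V3 → Fin 3 → ℂ) (η : V3) : ℝ≥0∞ := ENNReal.ofReal (Real.sqrt (vnSq (U η)))

theorem vnSq_nonneg (v : Fin 3 → ℂ) : 0 ≤ vnSq v := Finset.sum_nonneg fun _ _ => sq_nonneg _

theorem enorm_le_fieldSize (U : V3 → Fin 3 → ℂ) (η : V3) (k : Fin 3) :
    ‖U η k‖ₑ ≤ fieldSize U η := by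
  rw [← ofReal_norm]
  exact ENNReal.ofReal_le_ofReal (Real.le_sqrt_of_sq_le
    (Finset.single_le_sum (f := fun i => ‖U η i‖ ^ 2) (fun _ _ => sq_nonneg _)
      (Finset.mem_univ k)))

theorem measurable_fieldSize {U : V3 → Fin 3 → ℂ} (hU : ∀ j, Measurable fun ξ => U ξ j) :
    Measurable (fieldSize U) := by
  unfold fieldSize vnSq
  fun_prop

theorem wnorm_eq {w : V3 → ℝ} (hw : ∀ ξ, 0 ≤ w ξ) (U : V3 → Fin 3 → ℂ) :
    wnorm w U
      = (∫⁻ ξ, (ENNReal.ofReal (w ξ) * fieldSize U ξ) ^ 2) ^ ((1 : ℝ) / 2) := by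
  unfold wnorm
  congr 1
  refine lintegral_congr fun ξ => ?_
  rw [fieldSize, ← ENNReal.ofReal_mul (hw ξ),
    ← ENNReal.ofReal_pow (mul_nonneg (hw ξ) (Real.sqrt_nonneg _)), mul_pow,
    Real.sq_sqrt (vnSq_nonneg _)]

/-- Sum of the absolute values of the coefficients of `Q`. -/
def coeffSum (α : Coeffs) : ℝ := ∑ j, ∑ k, ∑ l, ∑ m, ∑ n, ∑ p, |α j m n p k l|

theorem coeffSum_nonneg (α : Coeffs) : 0 ≤ coeffSum α := by
  unfold coeffSum
  positivity

theorem enorm_Qhat_le (α : Coeffs) (U : V3 → Fin 3 → ℂ) (ξ : V3) (j : Fin 3) :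
    ‖Qhat α U U ξ j‖ₑ ≤ ENNReal.ofReal (∑ k, ∑ l, ∑ m, ∑ n, ∑ p, |α j m n p k l|) *
      (ENNReal.ofReal (en ξ) * ∫⁻ η, fieldSize U η * fieldSize U (ξ - η)) := by
  set P := ∫⁻ η, fieldSize U η * fieldSize U (ξ - η) with hP
  have hterm : ∀ k l m : Fin 3, ‖(qsym α j m k l ξ : ℂ) * (Complex.I * (ξ m : ℂ)) *
      ((((2 * Real.pi) ^ (3 : ℕ))⁻¹ : ℝ) : ℂ) * ∫ η : V3, U η k * U (ξ - η) l‖ₑ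
      ≤ ENNReal.ofReal (∑ n, ∑ p, |α j m n p k l|) * (ENNReal.ofReal (en ξ) * P) := by
    intro k l m
    have hint : ‖∫ η : V3, U η k * U (ξ - η) l‖ₑ ≤ P := by
      refine (enorm_integral_le_lintegral_enorm _).trans (lintegral_mono fun η => ?_)
      rw [enorm_mul]
      exact mul_le_mul' (enorm_le_fieldSize U η k) (enorm_le_fieldSize U (ξ - η) l)
    have hpi : ((2 * Real.pi) ^ (3 : ℕ))⁻¹ ≤ 1 :=
      inv_le_one_of_one_le₀ (one_le_pow₀ (by linarith [Real.pi_gt_three]))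
    rw [enorm_mul, ← mul_assoc (ENNReal.ofReal _) (ENNReal.ofReal _),
      ← ENNReal.ofReal_mul (by positivity)]
    refine mul_le_mul' ?_ hint
    rw [← ofReal_norm]
    apply ENNReal.ofReal_le_ofReal
    rw [norm_mul, norm_mul, norm_mul, Complex.norm_I, one_mul, Complex.norm_real,
      Complex.norm_real, Complex.norm_real, Real.norm_eq_abs, Real.norm_eq_abs,
      Real.norm_of_nonneg (by positivity)]
    calc _ ≤ (∑ n, ∑ p, |α j m n p k l|) * en ξ * 1 := by
          gcongr
          · exact mul_nonneg (by positivity) (en_nonneg ξ)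
          · exact abs_qsym_le α j m k l ξ
          · exact abs_apply_le_en ξ m
      _ = _ := mul_one _
  have hnn : ∀ k l m : Fin 3, 0 ≤ ∑ n, ∑ p, |α j m n p k l| := fun _ _ _ => by positivity
  rw [ENNReal.ofReal_sum_of_nonneg fun _ _ => by positivity, Finset.sum_mul]
  refine (enorm_sum_le _ _).trans (Finset.sum_le_sum fun k _ => ?_)
  rw [ENNReal.ofReal_sum_of_nonneg fun _ _ => by positivity, Finset.sum_mul]
  refine (enorm_sum_le _ _).trans (Finset.sum_le_sum fun l _ => ?_)
  rw [ENNReal.ofReal_sum_of_nonneg fun _ _ => by positivity, Finset.sum_mul]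
  exact (enorm_sum_le _ _).trans (Finset.sum_le_sum fun m _ => hterm k l m)

theorem fieldSize_le_sum (U : V3 → Fin 3 → ℂ) (ξ : V3) : fieldSize U ξ ≤ ∑ j, ‖U ξ j‖ₑ := by
  simp only [← ofReal_norm]
  rw [← ENNReal.ofReal_sum_of_nonneg fun _ _ => norm_nonneg _]
  refine ENNReal.ofReal_le_ofReal (Real.sqrt_le_iff.2 ⟨by positivity, ?_⟩)
  exact Finset.sum_sq_le_sq_sum_of_nonneg fun _ _ => norm_nonneg _

theorem fieldSize_Qhat_le (α : Coeffs) (U : V3 → Fin 3 → ℂ) (ξ : V3) :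
    fieldSize (Qhat α U U) ξ ≤ ENNReal.ofReal (coeffSum α) *
      (ENNReal.ofReal (en ξ) * ∫⁻ η, fieldSize U η * fieldSize U (ξ - η)) := by
  rw [coeffSum, ENNReal.ofReal_sum_of_nonneg fun _ _ => by positivity, Finset.sum_mul]
  exact (fieldSize_le_sum _ _).trans (Finset.sum_le_sum fun j _ => enorm_Qhat_le α U ξ j)

theorem one_le_rpow_neg_mul {η : V3} (hη : η ≠ 0) :
    1 ≤ ‖η‖ ^ (-(3 / 4) : ℝ) * en η ^ ((3 : ℝ) / 4) := by
  have h : 0 < ‖η‖ := norm_pos_iff.2 hη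
  rw [Real.rpow_neg h.le, inv_mul_eq_div, one_le_div (by positivity)]
  exact Real.rpow_le_rpow h.le (norm_le_en η) (by norm_num)

/-- Pointwise bound of the weighted nonlinearity by a convolution of Gevrey-weighted sizes. -/
theorem weight_mul_fieldSize_Qhat_le (α : Coeffs) (U : V3 → Fin 3 → ℂ) {s t : ℝ} (hs : 0 ≤ s)
    (hst : s < t) {G : V3 → ℝ≥0∞}
    (hG : G = fun η => ENNReal.ofReal (en η ^ ((3 : ℝ) / 4) * Real.exp (Real.sqrt s / 2 * en η))
      * fieldSize U η) (ξ : V3) :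
    ENNReal.ofReal (en ξ ^ ((3 : ℝ) / 4) *
        Real.exp (Real.sqrt t / 2 * en ξ - (t - s) * en ξ ^ 2)) * fieldSize (Qhat α U U) ξ
      ≤ ENNReal.ofReal (4 * coeffSum α * (t - s) ^ (-(7 / 8) : ℝ)) *
        ∫⁻ η : V3, (ENNReal.ofReal (‖η‖ ^ (-(3 / 4) : ℝ)) * G η) *
          (ENNReal.ofReal (‖ξ - η‖ ^ (-(3 / 4) : ℝ)) * G (ξ - η)) := by
  have hτ : 0 < t - s := sub_pos.2 hst
  have hM := coeffSum_nonneg α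
  have hw : 0 ≤ en ξ ^ ((3 : ℝ) / 4) := Real.rpow_nonneg (en_nonneg ξ) _
  set E : V3 → ℝ := fun η => Real.exp (Real.sqrt s / 2 * en η) with hE
  have hEG : ∀ η ≠ 0, ENNReal.ofReal (E η) * fieldSize U η
      ≤ ENNReal.ofReal (‖η‖ ^ (-(3 / 4) : ℝ)) * G η := by
    intro η hη
    rw [hG, ← mul_assoc, ← ENNReal.ofReal_mul (by positivity)]
    gcongr
    rw [← mul_assoc]
    exact le_mul_of_one_le_left (Real.exp_pos _).le (one_le_rpow_neg_mul hη)
  have hEξ : ∀ η, E ξ ≤ E η * E (ξ - η) := by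
    intro η
    simp only [hE]
    rw [← Real.exp_add, ← mul_add]
    gcongr
    exact en_le_add_sub ξ η
  have hne : ∀ᵐ η : V3, η ≠ 0 ∧ ξ - η ≠ 0 := by
    have h0 : ∀ᵐ η : V3, η ≠ 0 := by simp [ae_iff]
    have h1 : ∀ᵐ η : V3, η ≠ ξ := by simp [ae_iff]
    filter_upwards [h0, h1] with η h0 h1 using ⟨h0, sub_ne_zero.2 h1.symm⟩
  calc _ ≤ ENNReal.ofReal (en ξ ^ ((3 : ℝ) / 4) *
        Real.exp (Real.sqrt t / 2 * en ξ - (t - s) * en ξ ^ 2)) *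
        (ENNReal.ofReal (coeffSum α) *
          (ENNReal.ofReal (en ξ) * ∫⁻ η, fieldSize U η * fieldSize U (ξ - η))) := by
        gcongr
        exact fieldSize_Qhat_le α U ξ
    _ = ENNReal.ofReal (coeffSum α * (en ξ ^ ((3 : ℝ) / 4) *
        Real.exp (Real.sqrt t / 2 * en ξ - (t - s) * en ξ ^ 2) * en ξ)) *
          ∫⁻ η, fieldSize U η * fieldSize U (ξ - η) := by
        rw [ENNReal.ofReal_mul hM, ENNReal.ofReal_mul (q := en ξ) (by positivity)]
        ring
    _ ≤ ENNReal.ofReal (coeffSum α * (4 * (t - s) ^ (-(7 / 8) : ℝ) * E ξ)) *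
          ∫⁻ η, fieldSize U η * fieldSize U (ξ - η) := by
        refine mul_le_mul' (ENNReal.ofReal_le_ofReal (mul_le_mul_of_nonneg_left ?_ hM)) le_rfl
        exact heat_gevrey_multiplier_le hs hst (en_nonneg ξ)
    _ = ENNReal.ofReal (4 * coeffSum α * (t - s) ^ (-(7 / 8) : ℝ)) *
          ∫⁻ η, ENNReal.ofReal (E ξ) * (fieldSize U η * fieldSize U (ξ - η)) := by
        rw [lintegral_const_mul' _ _ ENNReal.ofReal_ne_top, ← mul_assoc (ENNReal.ofReal _),
          ← ENNReal.ofReal_mul (by positivity)]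
        congr 2
        ring
    _ ≤ _ := by
        refine mul_le_mul' le_rfl (lintegral_mono_ae ?_)
        filter_upwards [hne] with η hη
        calc _ ≤ ENNReal.ofReal (E η * E (ξ - η)) * (fieldSize U η * fieldSize U (ξ - η)) := by
              gcongr
              exact hEξ η
          _ = (ENNReal.ofReal (E η) * fieldSize U η) *
              (ENNReal.ofReal (E (ξ - η)) * fieldSize U (ξ - η)) := by
              rw [ENNReal.ofReal_mul (Real.exp_pos _).le]
              ring
          _ ≤ _ := mul_le_mul' (hEG η hη.1) (hEG _ hη.2)

/-- Bilinear estimate at a fixed pair of times `s < t`. -/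
theorem exists_wnorm_Qhat_le (α : Coeffs) :
    ∃ C : ℝ, 0 ≤ C ∧ ∀ U : V3 → Fin 3 → ℂ, (∀ j, Measurable fun ξ => U ξ j) →
      ∀ s t : ℝ, 0 ≤ s → s < t →
        wnorm (fun ξ => en ξ ^ ((3 : ℝ) / 4) *
            Real.exp (Real.sqrt t / 2 * en ξ - (t - s) * en ξ ^ 2)) (Qhat α U U)
          ≤ ENNReal.ofReal (C * (t - s) ^ (-(7 / 8) : ℝ)) *
            wnorm (fun ξ => en ξ ^ ((3 : ℝ) / 4) * Real.exp (Real.sqrt s / 2 * en ξ)) U ^ 2 := by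
  obtain ⟨K, hK, hconv⟩ := exists_lintegral_sq_conv_le
  have hM := coeffSum_nonneg α
  refine ⟨4 * coeffSum α * Real.sqrt K, by positivity, fun U hU s t hs hst => ?_⟩
  have hτ : 0 < t - s := sub_pos.2 hst
  have hw : ∀ ξ, 0 ≤ en ξ ^ ((3 : ℝ) / 4) := fun ξ => Real.rpow_nonneg (en_nonneg ξ) _
  rw [wnorm_eq fun ξ => mul_nonneg (hw ξ) (Real.exp_pos _).le,
    wnorm_eq fun ξ => mul_nonneg (hw ξ) (Real.exp_pos _).le]
  set G : V3 → ℝ≥0∞ := fun η =>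
    ENNReal.ofReal (en η ^ ((3 : ℝ) / 4) * Real.exp (Real.sqrt s / 2 * en η))
      * fieldSize U η with hG
  have hGm : Measurable G := by
    have := measurable_en
    have := measurable_fieldSize hU
    fun_prop
  set a : ℝ := 4 * coeffSum α * (t - s) ^ (-(7 / 8) : ℝ) with ha
  have ha0 : 0 ≤ a := by positivity
  have hsq : ∀ b : ℝ≥0∞, (b ^ ((1 : ℝ) / 2)) ^ 2 = b := fun b => by
    rw [← ENNReal.rpow_natCast, ← ENNReal.rpow_mul]; norm_num
  have hmain : ∫⁻ ξ, (ENNReal.ofReal (en ξ ^ ((3 : ℝ) / 4) *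
        Real.exp (Real.sqrt t / 2 * en ξ - (t - s) * en ξ ^ 2)) * fieldSize (Qhat α U U) ξ) ^ 2
      ≤ (ENNReal.ofReal (a * Real.sqrt K) * ∫⁻ ξ, G ξ ^ 2) ^ 2 := by
    calc _ ≤ ∫⁻ ξ, ENNReal.ofReal a ^ 2 *
          (∫⁻ η : V3, (ENNReal.ofReal (‖η‖ ^ (-(3 / 4) : ℝ)) * G η) *
          (ENNReal.ofReal (‖ξ - η‖ ^ (-(3 / 4) : ℝ)) * G (ξ - η))) ^ 2 := by
          refine lintegral_mono fun ξ => ?_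
          rw [← mul_pow]
          exact pow_le_pow_left' (weight_mul_fieldSize_Qhat_le α U hs hst hG ξ) 2
      _ ≤ ENNReal.ofReal a ^ 2 * (ENNReal.ofReal K * (∫⁻ ξ, G ξ ^ 2) ^ 2) := by
          rw [lintegral_const_mul' _ _ (by finiteness)]
          gcongr
          exact hconv G hGm
      _ = _ := by
          rw [mul_pow, ← mul_assoc, ENNReal.ofReal_mul ha0, mul_pow,
            ← ENNReal.ofReal_pow (Real.sqrt_nonneg K), Real.sq_sqrt hK]
  calc _ ≤ ((ENNReal.ofReal (a * Real.sqrt K) * ∫⁻ ξ, G ξ ^ 2) ^ 2) ^ ((1 : ℝ) / 2) :=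
        ENNReal.rpow_le_rpow hmain (by norm_num)
    _ = ENNReal.ofReal (a * Real.sqrt K) * ∫⁻ ξ, G ξ ^ 2 := by
        rw [← ENNReal.rpow_natCast, ← ENNReal.rpow_mul]; norm_num
    _ = _ := by
        rw [hsq]
        congr 2
        rw [ha]
        ring

theorem wnorm_sq_le_Znorm {T s : ℝ} (U : ℝ → V3 → Fin 3 → ℂ) (hs : s ∈ Ioc 0 T) :
    wnorm (fun ξ => en ξ ^ ((3 : ℝ) / 4) * Real.exp (Real.sqrt s / 2 * en ξ)) (U s) ^ 2
      ≤ ENNReal.ofReal (s ^ (-(1 / 4) : ℝ)) * Znorm T U ^ 2 := by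
  have hs0 : 0 < s := hs.1
  set N := wnorm (fun ξ => en ξ ^ ((3 : ℝ) / 4) * Real.exp (Real.sqrt s / 2 * en ξ)) (U s)
  have hZ : ENNReal.ofReal (s ^ ((1 : ℝ) / 8)) * N ≤ Znorm T U :=
    le_iSup₂ (f := fun t (_ : t ∈ Ioc (0 : ℝ) T) => ENNReal.ofReal (t ^ ((1 : ℝ) / 8)) *
      wnorm (fun ξ => en ξ ^ ((3 : ℝ) / 4) * Real.exp (Real.sqrt t / 2 * en ξ)) (U t)) s hs
  calc N ^ 2 = ENNReal.ofReal (s ^ (-(1 / 4) : ℝ)) *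
        (ENNReal.ofReal (s ^ ((1 : ℝ) / 8)) * N) ^ 2 := by
        rw [mul_pow, ← mul_assoc, ← ENNReal.ofReal_pow (by positivity),
          ← ENNReal.ofReal_mul (by positivity), ← Real.rpow_natCast, ← Real.rpow_mul hs0.le,
          ← Real.rpow_add hs0]
        norm_num
    _ ≤ _ := by gcongr

/-- nonlinear Gevrey estimate in the `Z_T` norm. -/
theorem statement16 (α : Coeffs) :
    ∃ C > (0 : ℝ), ∀ T : ℝ, 0 < T → ∀ U : ℝ → V3 → Fin 3 → ℂ, MeasVF U →
      Znorm T U < ⊤ →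
      ∀ t ∈ Ioc (0 : ℝ) T,
        ENNReal.ofReal (t ^ ((1 : ℝ) / 8)) *
            ∫⁻ s in Ioc (0 : ℝ) t,
              wnorm (fun ξ => en ξ ^ ((3 : ℝ) / 4) *
                  Real.exp (Real.sqrt t / 2 * en ξ - (t - s) * en ξ ^ 2))
                (Qhat α (U s) (U s))
          ≤ ENNReal.ofReal C * Znorm T U ^ (2 : ℕ) := by
  obtain ⟨C, hC, hQ⟩ := exists_wnorm_Qhat_le α
  refine ⟨20 * C + 1, by positivity, fun T _ U hU _ t ht => ?_⟩
  have ht0 : 0 < t := ht.1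
  have hUm : ∀ s j, Measurable fun ξ => U s ξ j := fun s j =>
    (hU j).comp measurable_prodMk_left
  have hpt : ∀ s ∈ Ioo (0 : ℝ) t,
      wnorm (fun ξ => en ξ ^ ((3 : ℝ) / 4) *
          Real.exp (Real.sqrt t / 2 * en ξ - (t - s) * en ξ ^ 2)) (Qhat α (U s) (U s))
        ≤ ENNReal.ofReal C * Znorm T U ^ 2 *
          ENNReal.ofReal ((t - s) ^ (-(7 / 8) : ℝ) * s ^ (-(1 / 4) : ℝ)) := by
    intro s hs
    have hτ : 0 < t - s := sub_pos.2 hs.2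
    calc _ ≤ ENNReal.ofReal (C * (t - s) ^ (-(7 / 8) : ℝ)) *
          (ENNReal.ofReal (s ^ (-(1 / 4) : ℝ)) * Znorm T U ^ 2) := by
          refine (hQ (U s) (hUm s) s t hs.1.le hs.2).trans ?_
          gcongr
          exact wnorm_sq_le_Znorm U ⟨hs.1, hs.2.le.trans ht.2⟩
      _ = _ := by
          rw [ENNReal.ofReal_mul hC, ENNReal.ofReal_mul (by positivity)]
          ring
  calc _ ≤ ENNReal.ofReal (t ^ ((1 : ℝ) / 8)) * (ENNReal.ofReal C * Znorm T U ^ 2 *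
        ENNReal.ofReal (20 * t ^ (-(1 / 8) : ℝ))) := by
        gcongr
        rw [← setLIntegral_congr Ioo_ae_eq_Ioc]
        refine (setLIntegral_mono' measurableSet_Ioo hpt).trans ?_
        rw [setLIntegral_congr Ioo_ae_eq_Ioc, lintegral_const_mul _ (by fun_prop)]
        gcongr
        exact lintegral_time_kernel_le ht0
    _ = ENNReal.ofReal (20 * C) * Znorm T U ^ 2 := by
        have h1 : t ^ ((1 : ℝ) / 8) * (20 * t ^ (-(1 / 8) : ℝ)) = 20 := by
          rw [mul_left_comm, ← Real.rpow_add ht0]; norm_num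
        rw [mul_left_comm, ← ENNReal.ofReal_mul (by positivity), h1,
          ENNReal.ofReal_mul (by norm_num)]
        ring
    _ ≤ _ := by
        gcongr
        linarith
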